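/- Let R be a commutative ring, M an R-module, N an R-module, and Q : M → N a quadratic map. Then for any finite list of elements x_1, …, x_t ∈ M, one has the identity 2·Q(x_1 + ⋯ + x_t) + ∑_{i=1}^t ∑_{j=1}^t Q(x_i − x_j) = 2t·∑_{i=1}^t Q(x_i). -/

import Mathlib

/-- Expansion of a quadratic map at a difference in terms of its polar form. -/
theorem QuadraticMap.map_sub_eq_add_sub_polar
    {R M N : Type*} [CommRing R] [AddCommGroup M] [Module R M]
    [AddCommGroup N] [Module R N] (Q : QuadraticMap R M N) (x y : M) :
    Q (x - y) = Q x + Q y - QuadraticMap.polar Q x y := by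
  rw [sub_eq_add_neg x y, QuadraticMap.map_add Q, QuadraticMap.map_neg,
    QuadraticMap.polar_neg_right, ← sub_eq_add_neg]

/-- Twice the value of a quadratic map at a finite sum is the double sum of its polar form. -/
theorem QuadraticMap.two_nsmul_map_sum
    {R M N ι : Type*} [CommRing R] [AddCommGroup M] [Module R M]
    [AddCommGroup N] [Module R N] (Q : QuadraticMap R M N) (s : Finset ι) (x : ι → M) :
    2 • Q (∑ i ∈ s, x i) = ∑ i ∈ s, ∑ j ∈ s, QuadraticMap.polar Q (x i) (x j) := by
  rw [← QuadraticMap.polar_self, ← QuadraticMap.polarBilin_apply_apply]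
  simp only [map_sum, LinearMap.sum_apply, QuadraticMap.polarBilin_apply_apply]
  exact Finset.sum_comm


/-- generalized parallelogram law, Remark 6.2 of Baker–Silverman: For a
quadratic map `Q : M → N` of modules over a commutative ring `R` and elements
`x_1, …, x_t ∈ M`, one has
`2·Q(x_1 + ⋯ + x_t) + ∑_{i,j} Q(x_i - x_j) = 2t·∑_i Q(x_i)`. -/
theorem quadraticMap_parallelogram_law
    {R M N : Type*} [CommRing R] [AddCommGroup M] [Module R M]
    [AddCommGroup N] [Module R N] (Q : QuadraticMap R M N)
    (t : ℕ) (x : Fin t → M) :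
    2 • Q (∑ i, x i) + ∑ i, ∑ j, Q (x i - x j) = (2 * t) • ∑ i, Q (x i) := by
  simp only [QuadraticMap.two_nsmul_map_sum, QuadraticMap.map_sub_eq_add_sub_polar,
    Finset.sum_sub_distrib, Finset.sum_add_distrib, Finset.sum_const, Finset.card_univ,
    Fintype.card_fin, add_sub_cancel, ← Finset.smul_sum]
  rw [two_mul, add_nsmul]
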